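/- Let R be a commutative semihereditary ring and 𝔭 a prime ideal of R. If the class 𝒫₁(R) is covering in Mod-R, then the class 𝒫₁(R_𝔭) is covering in Mod-R_𝔭. Moreover, for every N ∈ ℬ(R) one has N ⊗_R R_𝔭 ∈ ℬ(R_𝔭). -/

import Mathlib

universe u

open MulOpposite Function

/-- An `A`-module `M` has projective dimension at most 1, i.e. there is a short exact
sequence `0 → ker g → P → M → 0` with `P` and `ker g` projective. -/
def ProjDimLE1 (A : Type u) [Ring A] (M : Type u) [AddCommGroup M] [Module A M] : Prop :=
  ∃ (P : ModuleCat.{u} A) (g : P →ₗ[A] M), Module.Projective A P ∧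
    Function.Surjective g ∧ Module.Projective A (LinearMap.ker g)

/-- `Ext¹_A(X, Y) = 0`: every short exact sequence `0 → Y → E → X → 0` splits. -/
def Ext1Vanishes (A : Type u) [Ring A] (X Y : Type u) [AddCommGroup X] [Module A X]
    [AddCommGroup Y] [Module A Y] : Prop :=
  ∀ (E : Type u) [AddCommGroup E] [Module A E], ∀ (i : Y →ₗ[A] E) (p : E →ₗ[A] X),
    Function.Injective i → Function.Surjective p → LinearMap.range i = LinearMap.ker p →
    ∃ s : X →ₗ[A] E, p.comp s = LinearMap.id

/-- The class `ℬ(A) = 𝒫₁(A)^⊥₁` of modules `B` with `Ext¹_A(P, B) = 0` for every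
module `P` of projective dimension at most 1. -/
def BClass (A : Type u) [Ring A] : Set (ModuleCat.{u} A) :=
  {B | ∀ P : ModuleCat.{u} A, ProjDimLE1 A P → Ext1Vanishes A P B}

/-- `φ : P → M` is a `C`-cover of `M`: `P ∈ C`, every map from a module of `C` to `M`
factors through `φ`, and every endomorphism `e` of `P` with `φ ∘ e = φ` is an automorphism. -/
def IsCover (A : Type u) [Ring A] (C : Set (ModuleCat.{u} A)) (P : ModuleCat.{u} A)
    (M : Type u) [AddCommGroup M] [Module A M] (φ : P →ₗ[A] M) : Prop :=
  P ∈ C ∧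
  (∀ P' ∈ C, ∀ ψ : (P' : Type u) →ₗ[A] M, ∃ h : (P' : Type u) →ₗ[A] (P : Type u),
    φ.comp h = ψ) ∧
  (∀ e : (P : Type u) →ₗ[A] (P : Type u), φ.comp e = φ → Function.Bijective e)

/-- The class `C` is covering: every `A`-module admits a `C`-cover. -/
def IsCoveringClass (A : Type u) [Ring A] (C : Set (ModuleCat.{u} A)) : Prop :=
  ∀ M : ModuleCat.{u} A, ∃ (P : ModuleCat.{u} A) (φ : P →ₗ[A] (M : Type u)),
    IsCover A C P (M : Type u) φ

/-- The class `𝒫₁(A)` of modules of projective dimension at most one. -/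
def P1Class (A : Type u) [Ring A] : Set (ModuleCat.{u} A) := {M | ProjDimLE1 A M}

section ValExt
set_option linter.unusedSectionVars false
set_option linter.style.haveILetI false
open Finsupp

variable {V : Type u} [CommRing V] [IsDomain V] {D : Type u} [AddCommGroup D] [Module V D]
variable {ι κ : Type u} {K : Type u} [AddCommGroup K] [Module V K] (j : K →ₗ[V] (ι →₀ V))

def UniMod (X : Set ι) : Prop :=
  ∀ l : K, (j l) ∉ supported V V X → ∃ (d : V) (l0 : K) (φ : K →ₗ[V] V),
    (∀ m : K, (j m) ∈ supported V V X → φ m = 0) ∧ φ l0 = 1 ∧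
    j (l - d • l0) ∈ supported V V X

theorem pmap_ext_one (hD : ∀ a : V, a ≠ 0 → ∀ d : D, ∃ m : D, a • m = d)
    {E : Type u} [AddCommGroup E] [Module V E] (g : E →ₗ.[V] D) (x : E)
    (hx : ∀ c : V, c • x = 0 → c = 0) (a : V) (hax : a • x ∈ g.domain)
    (hr : ∀ r : V, r • x ∈ g.domain → a ∣ r) :
    ∃ g' : E →ₗ.[V] D, g ≤ g' ∧ g'.domain = g.domain ⊔ Submodule.span V {x} := by
  obtain ⟨y, hy⟩ : ∃ y : D, a • y = g ⟨a • x, hax⟩ := by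
    by_cases ha : a = 0
    · subst ha
      refine ⟨0, ?_⟩
      have : (⟨(0 : V) • x, hax⟩ : g.domain) = 0 := by ext; simp
      rw [this]; simp
    · exact hD a ha _
  have H : ∀ c : V, c • x = 0 → (RingHom.id V c) • y = 0 := by
    intro c hc; rw [hx c hc]; simp
  refine ⟨g.sup (LinearPMap.mkSpanSingleton' x y H) ?_, LinearPMap.left_le_sup _ _ _, rfl⟩
  rintro ⟨z, hz⟩ ⟨w, hw⟩ hzw
  simp only at hzw
  subst hzw
  obtain ⟨r, rfl⟩ := Submodule.mem_span_singleton.1 hw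
  obtain ⟨b, rfl⟩ := hr r hz
  rw [LinearPMap.mkSpanSingleton'_apply]
  have : (⟨(a * b) • x, hz⟩ : g.domain) = b • ⟨a • x, hax⟩ := by
    ext; simp [smul_smul, mul_comm]
  rw [this, LinearPMap.map_smul, ← hy, smul_smul, mul_comm]; rfl

theorem supp_insert_zero {X : Set ι} {x : ι} {l : ι →₀ V}
    (hl : l ∈ supported V V (insert x X)) (h0 : l x = 0) : l ∈ supported V V X := by
  rw [mem_supported'] at *
  intro y hy
  by_cases hyx : y = x
  · rw [hyx, h0]
  · exact hl y (by simp [hyx, hy])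

theorem supp_insert_eq (X : Set ι) (x : ι) :
    supported V V (insert x X) = supported V V X ⊔ Submodule.span V {single x (1 : V)} := by
  rw [Set.insert_eq, Set.union_comm, supported_union]
  congr 1
  rw [supported_eq_span_single]; simp

theorem supp_smul {X : Set ι} {d : V} (hd : d ≠ 0) {l : ι →₀ V}
    (h : d • l ∈ supported V V X) : l ∈ supported V V X := by
  rw [mem_supported'] at *
  intro y hy
  have := h y hy
  simpa [hd] using this

theorem uni_step (hD : ∀ a : V, a ≠ 0 → ∀ d : D, ∃ m : D, a • m = d)
    (X : Set ι) (hU : UniMod j X) (g : (ι →₀ V) →ₗ.[V] D)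
    (hg : g.domain = LinearMap.range j ⊔ supported V V X) (x : ι) :
    UniMod j (insert x X) ∧
    (∃ g' : (ι →₀ V) →ₗ.[V] D, g ≤ g' ∧ g'.domain = LinearMap.range j ⊔ supported V V (insert x X)) ∧
    ∃ l0 : K, ∀ l : K, (j l) ∈ supported V V (insert x X) →
      ∃ c : V, j (l - c • l0) ∈ supported V V X := by
  by_cases hxX : x ∈ X
  · rw [Set.insert_eq_of_mem hxX]
    exact ⟨hU, ⟨g, le_rfl, hg⟩, 0, fun l hl => ⟨0, by simpa using hl⟩⟩
  have hsub : supported V V X ≤ supported V V (insert x X) :=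
    supported_mono (Set.subset_insert _ _)
  have hx1 : ∀ c : V, c • (single x (1 : V)) = 0 → c = 0 := by
    intro c hc
    simpa using hc
  have key : ∀ r : V, r • (single x (1:V)) ∈ g.domain →
      ∃ k : K, j k ∈ supported V V (insert x X) ∧ (j k) x = r := by
    intro r hr
    rw [hg, Submodule.mem_sup] at hr
    obtain ⟨_, ⟨k, rfl⟩, m, hm, hkm⟩ := hr
    refine ⟨k, ?_, ?_⟩
    · have : j k = r • (single x (1:V)) - m := by rw [← hkm]; simp
      simp only [this]
      exact Submodule.sub_mem _ (Submodule.smul_mem _ _ (single_mem_supported _ _ (by simp))) (hsub hm)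
    · have := DFunLike.congr_fun hkm x
      rw [mem_supported'] at hm
      simpa [hm x hxX] using this
  by_cases hA : ∀ l : K, (j l) ∈ supported V V (insert x X) →
      (j l) ∈ supported V V X
  · refine ⟨?_, ?_, 0, fun l hl => ⟨0, by simpa using hA l hl⟩⟩
    · intro l hl
      obtain ⟨d, l0, φ, h1, h2, h3⟩ := hU l (fun h => hl (hsub h))
      exact ⟨d, l0, φ, fun m hm => h1 m (hA m hm), h2, hsub h3⟩
    · obtain ⟨g', h1, h2⟩ := pmap_ext_one hD g (single x (1:V)) hx1 0 (by simp) (by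
        intro r hr
        obtain ⟨k, hk, hkr⟩ := key r hr
        have := (mem_supported' V _).1 (hA k hk) x hxX
        rw [← hkr, this])
      exact ⟨g', h1, by rw [h2, hg, supp_insert_eq, sup_assoc]⟩
  · push Not at hA
    obtain ⟨l, hl, hlX⟩ := hA
    obtain ⟨d, l0, φ, hφ, hφ1, hdl⟩ := hU l hlX
    have hd : d ≠ 0 := by
      rintro rfl
      apply hlX
      simpa using hdl
    have hl0 : (j l0) ∈ supported V V (insert x X) := by
      apply supp_smul hd
      have : d • (j l0) = j l - j (l - d • l0) := by simp
      rw [this]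
      exact Submodule.sub_mem _ hl (hsub hdl)
    have hc : ∀ m : K, (j m) ∈ supported V V (insert x X) →
        (j m) x = (j l0) x * φ m := by
      intro m hm
      have h1 : j ((j l0) x • m - (j m) x • l0) ∈ supported V V X := by
        apply supp_insert_zero (x := x)
        · rw [map_sub, map_smul, map_smul]; exact Submodule.sub_mem _ (Submodule.smul_mem _ _ hm) (Submodule.smul_mem _ _ hl0)
        · simp [mul_comm]
      have h2 := hφ _ h1
      simp only [map_sub, map_smul, smul_eq_mul, hφ1, mul_one] at h2
      exact (sub_eq_zero.1 h2).symm
    have hdec : ∀ m : K, (j m) ∈ supported V V (insert x X) →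
        j (m - φ m • l0) ∈ supported V V X := by
      intro m hm
      apply supp_insert_zero (x := x)
      · rw [map_sub, map_smul]; exact Submodule.sub_mem _ hm (Submodule.smul_mem _ _ hl0)
      · simp [hc m hm, mul_comm]
    refine ⟨?_, ?_, l0, fun m hm => ⟨φ m, hdec m hm⟩⟩
    · intro l1 hl1
      have hl' : j (l1 - φ l1 • l0) ∉ supported V V X := by
        intro h
        apply hl1
        have : (j l1) = j (l1 - φ l1 • l0) + φ l1 • j l0 := by simp
        rw [this]
        exact Submodule.add_mem _ (hsub h) (Submodule.smul_mem _ _ hl0)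
      obtain ⟨d1, l2, φ1, hφ1X, hφ1l, hd1⟩ := hU _ hl'
      have hd10 : d1 ≠ 0 := by
        rintro rfl
        apply hl'
        simpa using hd1
      have hφl2 : φ l2 = 0 := by
        have := hφ _ hd1
        simp only [map_sub, map_smul, smul_eq_mul, hφ1, mul_one, sub_self, zero_sub,
          neg_eq_zero, mul_eq_zero, hd10, false_or] at this
        exact this
      refine ⟨d1, l2, φ1 - φ1 l0 • φ, ?_, ?_, ?_⟩
      · intro m hm
        have := hφ1X _ (hdec m hm)
        simp only [map_sub, map_smul, smul_eq_mul] at this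
        simp only [LinearMap.sub_apply, LinearMap.smul_apply, smul_eq_mul]
        rw [mul_comm]; exact this
      · simp [hφl2, hφ1l]
      · have : j (l1 - d1 • l2) = j (l1 - φ l1 • l0 - d1 • l2) + φ l1 • j l0 := by
          simp only [map_sub, map_smul]; abel
        rw [this]
        exact Submodule.add_mem _ (hsub hd1) (Submodule.smul_mem _ _ hl0)
    · obtain ⟨g', h1, h2⟩ := pmap_ext_one hD g (single x (1:V)) hx1 ((j l0) x) (by
        have h : ((j l0) x • single x (1:V) : ι →₀ V)
            = j l0 - ((j l0) - (j l0) x • single x (1:V)) := by simp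
        rw [h, hg]
        refine Submodule.sub_mem _ (Submodule.mem_sup_left ⟨l0, rfl⟩) (Submodule.mem_sup_right ?_)
        apply supp_insert_zero (x := x)
        · exact Submodule.sub_mem _ hl0 (Submodule.smul_mem _ _ (single_mem_supported _ _ (by simp)))
        · simp) (by
        intro r hr
        obtain ⟨k, hk, hkr⟩ := key r hr
        rw [← hkr, hc k hk]
        exact Dvd.intro _ rfl)
      exact ⟨g', h1, by rw [h2, hg, supp_insert_eq, sup_assoc]⟩

theorem uni_finite (hD : ∀ a : V, a ≠ 0 → ∀ d : D, ∃ m : D, a • m = d)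
    (X : Set ι) (hU : UniMod j X) (g : (ι →₀ V) →ₗ.[V] D)
    (hg : g.domain = LinearMap.range j ⊔ supported V V X) (t : Set ι) (ht : t.Finite) :
    UniMod j (t ∪ X) ∧
    (∃ g' : (ι →₀ V) →ₗ.[V] D, g ≤ g' ∧ g'.domain = LinearMap.range j ⊔ supported V V (t ∪ X)) ∧
    ∃ s : Set K, s.Finite ∧ ∀ l : K, (j l) ∈ supported V V (t ∪ X) →
      ∃ c ∈ Submodule.span V s, j (l - c) ∈ supported V V X := by
  induction t, ht using Set.Finite.induction_on with
  | empty =>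
    rw [Set.empty_union]
    exact ⟨hU, ⟨g, le_rfl, hg⟩, ∅, Set.finite_empty, fun l hl => ⟨0, by simp, by simpa using hl⟩⟩
  | @insert x t hx ht ih =>
    obtain ⟨h1, ⟨g', hgg', hg'⟩, s, hs, hs'⟩ := ih
    obtain ⟨k1, ⟨g2, hgg2, hg2⟩, l0, hl0⟩ := uni_step j hD _ h1 g' hg' x
    rw [Set.insert_union]
    refine ⟨k1, ⟨g2, hgg'.trans hgg2, hg2⟩, insert l0 s, hs.insert _, fun l hl => ?_⟩
    obtain ⟨c, hc⟩ := hl0 l hl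
    obtain ⟨c', hc', h⟩ := hs' _ hc
    refine ⟨c • l0 + c', ?_, ?_⟩
    · exact Submodule.add_mem _ (Submodule.smul_mem _ _ (Submodule.subset_span (by simp)))
        (Submodule.span_mono (Set.subset_insert _ _) hc')
    · rwa [← sub_sub]

theorem exists_min_dvd (hv : ∀ a b : V, a ∣ b ∨ b ∣ a) {α : Type*} (f : α → V)
    (s : Finset α) (hs : s.Nonempty) : ∃ z ∈ s, ∀ y ∈ s, f z ∣ f y := by
  classical
  induction hs using Finset.Nonempty.cons_induction with
  | singleton a => exact ⟨a, by simp⟩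
  | cons a s ha hs ih =>
    obtain ⟨z, hz, h⟩ := ih
    rcases hv (f a) (f z) with h1 | h1
    · refine ⟨a, by simp, fun y hy => ?_⟩
      rcases Finset.mem_cons.1 hy with rfl | hy
      · exact dvd_rfl
      · exact h1.trans (h y hy)
    · refine ⟨z, by simp [hz], fun y hy => ?_⟩
      rcases Finset.mem_cons.1 hy with rfl | hy
      · exact h1
      · exact h y hy

variable (i : K →ₗ[V] (κ →₀ V)) (ρ : (κ →₀ V) →ₗ[V] K)

def GoodSet (X : Set ι) : Prop := ∃ Y : Set κ,
  (∀ l : K, (j l) ∈ supported V V X → i l ∈ supported V V Y) ∧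
  (∀ h ∈ supported V V Y, j (ρ h) ∈ supported V V X)

theorem good_uni (hv : ∀ a b : V, a ∣ b ∨ b ∣ a) (hρ : ∀ k, ρ (i k) = k) (X : Set ι)
    (hX : GoodSet j i ρ X) : UniMod j X := by
  classical
  obtain ⟨Y, h1, h2⟩ := hX
  intro l hl
  set q : κ →₀ V := (i l).filter (fun y => y ∉ Y) with hq
  have hqd : i l - q ∈ supported V V Y := by
    rw [mem_supported']
    intro y hy
    simp [hq, hy]
  have hq0 : q.support.Nonempty := by
    rw [Finsupp.support_nonempty_iff]
    intro h
    apply hl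
    have := h2 _ hqd
    rwa [h, sub_zero, hρ] at this
  obtain ⟨z, hz, hzd⟩ := exists_min_dvd hv q q.support hq0
  have hzd' : ∀ y, q z ∣ q y := by
    intro y
    by_cases hy : y ∈ q.support
    · exact hzd y hy
    · rw [Finsupp.notMem_support_iff.1 hy]; exact dvd_zero _
  have hz0 : q z ≠ 0 := Finsupp.mem_support_iff.1 hz
  have hzY : z ∉ Y := by
    intro h
    apply hz0
    simp [hq, h]
  obtain ⟨h, hh⟩ : ∃ h : κ →₀ V, q = q z • h := by
    choose c hc using hzd'
    refine ⟨Finsupp.onFinset q.support c ?_, ?_⟩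
    · intro y hy
      rw [Finsupp.mem_support_iff]
      intro h
      rw [hc y] at h
      rcases mul_eq_zero.1 h with h | h
      · exact hz0 h
      · exact hy h
    · ext y
      simp [← hc y]
  have hhz : h z = 1 := by
    have := DFunLike.congr_fun hh z
    simp only [Finsupp.smul_apply, smul_eq_mul] at this
    exact mul_left_cancel₀ hz0 (by rw [← this, mul_one])
  have hlρ : j (l - q z • ρ h) ∈ supported V V X := by
    have := h2 _ hqd
    rw [map_sub, hρ] at this
    rw [← map_smul, ← hh]
    exact this
  refine ⟨q z, ρ h, (Finsupp.lapply z) ∘ₗ i, ?_, ?_, hlρ⟩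
  · intro m hm
    exact (mem_supported' V _).1 (h1 m hm) z hzY
  · have e1 := (mem_supported' V _).1 (h1 _ hlρ) z hzY
    have e2 := (mem_supported' V _).1 hqd z hzY
    simp only [map_sub, map_smul, Finsupp.sub_apply, Finsupp.smul_apply, smul_eq_mul] at e1 e2
    simp only [LinearMap.comp_apply, Finsupp.lapply_apply]
    apply mul_left_cancel₀ hz0
    linear_combination e2 - e1

theorem supported_directed {α : Type*} [Nonempty α] (X : α → Set ι)
    (hX : Directed (· ⊆ ·) X) (l : ι →₀ V) (hl : l ∈ supported V V (⋃ a, X a)) :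
    ∃ a, l ∈ supported V V (X a) := by
  rw [supported_iUnion] at hl
  exact (Submodule.mem_iSup_of_directed _ (fun a b => by
    obtain ⟨c, hc1, hc2⟩ := hX a b
    exact ⟨c, supported_mono hc1, supported_mono hc2⟩)).1 hl

theorem good_union {α : Type*} [Nonempty α] (X : α → Set ι) (hX : Directed (· ⊆ ·) X)
    (Y : α → Set κ)
    (h1 : ∀ a, ∀ l : K, (j l) ∈ supported V V (X a) → i l ∈ supported V V (Y a))
    (h2 : ∀ a, ∃ b, ∀ h ∈ supported V V (Y a), j (ρ h) ∈ supported V V (X b)) :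
    GoodSet j i ρ (⋃ a, X a) := by
  refine ⟨⋃ a, Y a, ?_, ?_⟩
  · intro l hl
    obtain ⟨a, ha⟩ := supported_directed X hX (j l) hl
    exact supported_mono (Set.subset_iUnion _ a) (h1 a l ha)
  · intro h hh
    rw [supported_iUnion] at hh
    have : (⨆ a, supported V V (Y a)) ≤ (supported V V (⋃ a, X a)).comap (j ∘ₗ ρ) := by
      refine iSup_le fun a h hh => ?_
      obtain ⟨b, hb⟩ := h2 a
      exact supported_mono (Set.subset_iUnion _ b) (hb h hh)
    exact this hh

theorem pmap_union {α : Type*} [Nonempty α] (X : α → Set ι) (g : α → (ι →₀ V) →ₗ.[V] D)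
    (hg : ∀ a, (g a).domain = LinearMap.range j ⊔ supported V V (X a)) (hd : Directed (· ≤ ·) g) :
    ∃ g' : (ι →₀ V) →ₗ.[V] D, (∀ a, g a ≤ g') ∧ g'.domain = LinearMap.range j ⊔ supported V V (⋃ a, X a) := by
  have hd' : DirectedOn (· ≤ ·) (Set.range g) := directedOn_range.2 hd
  refine ⟨LinearPMap.sSup _ hd', fun a => LinearPMap.le_sSup _ ⟨a, rfl⟩, ?_⟩
  rw [LinearPMap.domain_sSup, ← Set.range_comp, sSup_range, supported_iUnion, sup_iSup]
  exact iSup_congr hg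

theorem good_extend (hv : ∀ a b : V, a ∣ b ∨ b ∣ a)
    (hD : ∀ a : V, a ≠ 0 → ∀ d : D, ∃ m : D, a • m = d)
    (hρ : ∀ k, ρ (i k) = k) (X : Set ι) (hX : GoodSet j i ρ X) (g : (ι →₀ V) →ₗ.[V] D)
    (hg : g.domain = LinearMap.range j ⊔ supported V V X) (x : ι) :
    ∃ (X' : Set ι) (g' : (ι →₀ V) →ₗ.[V] D), X ⊆ X' ∧ x ∈ X' ∧ g ≤ g' ∧ GoodSet j i ρ X' ∧
      g'.domain = LinearMap.range j ⊔ supported V V X' := by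
  have hU := good_uni j i ρ hv hρ X hX
  obtain ⟨Y0, hY1, hY2⟩ := hX
  let St := {q : Set ι × ((ι →₀ V) →ₗ.[V] D) // UniMod j q.1 ∧ q.2.domain = LinearMap.range j ⊔ supported V V q.1 ∧
    ∃ s : Set K, s.Finite ∧ ∀ l : K, (j l) ∈ supported V V q.1 →
      ∃ c ∈ Submodule.span V s, j (l - c) ∈ supported V V X}
  have fin : ∀ (q : St) (t : Set ι), t.Finite → ∃ q' : St, q.1 ≤ q'.1 ∧ t ⊆ q'.1.1 := by
    rintro ⟨⟨X1, g1⟩, hU1, hg1, s, hs, hs'⟩ t ht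
    obtain ⟨h1, ⟨g2, hgg, hg2⟩, s2, hs2, hs2'⟩ := uni_finite j hD X1 hU1 g1 hg1 t ht
    refine ⟨⟨⟨t ∪ X1, g2⟩, h1, hg2, s2 ∪ s, hs2.union hs, ?_⟩, ⟨Set.subset_union_right, hgg⟩,
      Set.subset_union_left⟩
    intro l hl
    obtain ⟨c, hc, h⟩ := hs2' l hl
    obtain ⟨c', hc', h'⟩ := hs' _ h
    refine ⟨c + c', Submodule.add_mem _ (Submodule.span_mono Set.subset_union_left hc)
      (Submodule.span_mono Set.subset_union_right hc'), ?_⟩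
    rwa [← sub_sub]
  let q0 : St := ⟨⟨X, g⟩, hU, hg, ∅, Set.finite_empty, fun l hl => ⟨0, by simp, by simpa using hl⟩⟩
  obtain ⟨q1, hq01, hxq1⟩ := fin q0 {x} (Set.finite_singleton x)
  have next : ∀ q : St, ∃ q' : St, q.1 ≤ q'.1 ∧ (X ⊆ q.1.1 → ∃ Y : Set κ,
      (∀ l : K, (j l) ∈ supported V V q.1.1 → i l ∈ supported V V Y) ∧
      (∀ h ∈ supported V V Y, j (ρ h) ∈ supported V V q'.1.1)) := by
    intro q
    obtain ⟨s, hs, hs'⟩ := q.2.2.2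
    let T : Set κ := ⋃ l ∈ s, ((i l).support : Set κ)
    have hT : T.Finite := hs.biUnion fun l _ => Finset.finite_toSet _
    let t : Set ι := ⋃ y ∈ T, ((j (ρ (single y 1))).support : Set ι)
    have ht : t.Finite := hT.biUnion fun l _ => Finset.finite_toSet _
    obtain ⟨q', hqq', htq'⟩ := fin q t ht
    refine ⟨q', hqq', fun hXq => ⟨Y0 ∪ T, ?_, ?_⟩⟩
    · intro l hl
      obtain ⟨c, hc, hlc⟩ := hs' l hl
      have e : i l = i (l - c) + i c := by simp
      rw [e]
      refine Submodule.add_mem _ (supported_mono Set.subset_union_left (hY1 _ hlc)) ?_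
      have : Submodule.span V s ≤ (supported V V (Y0 ∪ T)).comap i := by
        rw [Submodule.span_le]
        intro l hl
        refine supported_mono (M := V) (R := V) Set.subset_union_right ?_
        exact Set.subset_biUnion_of_mem (u := fun l => ((i l).support : Set κ)) hl
      exact this hc
    · intro h hh
      rw [supported_union] at hh
      have : supported V V Y0 ⊔ supported V V T ≤
          (supported V V q'.1.1).comap (j ∘ₗ ρ) := by
        refine sup_le (fun h hh => ?_) ?_
        · exact supported_mono (hXq.trans hqq'.1) (hY2 h hh)
        · rw [supported_eq_span_single, Submodule.span_le]
          rintro _ ⟨y, hy, rfl⟩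
          refine Set.Subset.trans ?_ htq'
          exact Set.subset_biUnion_of_mem
            (u := fun y => ((j (ρ (single y 1))).support : Set ι)) hy
      exact this hh
  choose nx hnx1 hnx2 using next
  let f : ℕ → St := fun n => nx^[n] q1
  have hfs : ∀ n, f (n + 1) = nx (f n) := fun n => Function.iterate_succ_apply' _ _ _
  have hmono : Monotone (fun n => (f n).1) :=
    monotone_nat_of_le_succ fun n => by rw [hfs]; exact hnx1 _
  have hXf : ∀ n, X ⊆ (f n).1.1 := fun n => hq01.1.trans (hmono (Nat.zero_le n)).1
  have hYs := fun n => hnx2 (f n) (hXf n)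
  choose Y hY using hYs
  obtain ⟨g', hgg', hg'⟩ := pmap_union j (fun n => (f n).1.1) (fun n => (f n).1.2)
    (fun n => (f n).2.2.1) (Monotone.directed_le fun a b hab => (hmono hab).2)
  refine ⟨⋃ n, (f n).1.1, g', (hXf 0).trans (Set.subset_iUnion (fun n => (f n).1.1) 0), ?_, ?_, ?_, hg'⟩
  · exact Set.subset_iUnion (fun n => (f n).1.1) 0 (hxq1 rfl)
  · exact hq01.2.trans (hgg' 0)
  · refine good_union j i ρ _ (Monotone.directed_le fun a b hab => (hmono hab).1) Y
      (fun n => (hY n).1) (fun n => ⟨n + 1, ?_⟩)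
    rw [hfs]
    exact (hY n).2

theorem extend_free (hj : Function.Injective j) (hv : ∀ a b : V, a ∣ b ∨ b ∣ a)
    (hD : ∀ a : V, a ≠ 0 → ∀ d : D, ∃ m : D, a • m = d) [Module.Projective V K] (f : K →ₗ[V] D) :
    ∃ g : (ι →₀ V) →ₗ[V] D, ∀ k : K, g (j k) = f k := by
  obtain ⟨i, hi⟩ := Module.projective_def.1 (inferInstance : Module.Projective V K)
  set ρ : (K →₀ V) →ₗ[V] K := Finsupp.linearCombination V id
  let Z : Set (Set ι × ((ι →₀ V) →ₗ.[V] D)) :=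
    {q | GoodSet j i ρ q.1 ∧ q.2.domain = LinearMap.range j ⊔ supported V V q.1}
  obtain ⟨⟨X, g⟩, hle, hmax⟩ := zorn_le_nonempty₀ Z (by
    intro c hc hch y hy
    haveI : Nonempty c := ⟨⟨y, hy⟩⟩
    have hdir : Directed (· ≤ ·) (fun a : c => a.1) := hch.directed
    have hg := fun a : c => (hc a.2).1
    choose Y hY1 hY2 using hg
    obtain ⟨g', h1, h2⟩ := pmap_union j (fun a : c => a.1.1) (fun a : c => a.1.2)
      (fun a => (hc a.2).2) (fun a b => by
        obtain ⟨d, h1, h2⟩ := hdir a b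
        exact ⟨d, h1.2, h2.2⟩)
    refine ⟨(⋃ a : c, a.1.1, g'), ⟨good_union j i ρ _ (fun a b => by
        obtain ⟨d, h1, h2⟩ := hdir a b
        exact ⟨d, h1.1, h2.1⟩) Y hY1 (fun a => ⟨a, hY2 a⟩), h2⟩, fun z hz => ⟨?_, h1 ⟨z, hz⟩⟩⟩
    exact Set.subset_iUnion (fun a : c => a.1.1) ⟨z, hz⟩) (∅, ⟨LinearMap.range j, f ∘ₗ (LinearEquiv.ofInjective j hj).symm.toLinearMap⟩) (by
      refine ⟨⟨∅, ?_, ?_⟩, by simp⟩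
      · intro l hl
        have : l = 0 := hj (by simpa using hl)
        simp [this]
      · intro h hh
        have : h = 0 := by simpa using hh
        simp [this])
  have hX : X = Set.univ := by
    refine Set.eq_univ_of_forall fun x => ?_
    obtain ⟨X', g', h1, h2, h3, h4, h5⟩ := good_extend j i ρ hv hD hi X hmax.prop.1 g hmax.prop.2 x
    exact (hmax.le_of_ge (y := (X', g')) ⟨h4, h5⟩ ⟨h1, h3⟩).1 h2
  have hdom : g.domain = ⊤ := by
    have := hmax.prop.2
    simp only [hX] at this
    simpa using this
  refine ⟨g.toFun ∘ₗ LinearMap.codRestrict g.domain LinearMap.id (fun x => by simp [hdom]), fun k => ?_⟩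
  have := hle.2.2 (x := ⟨j k, ⟨k, rfl⟩⟩) (y := ⟨j k, by simp [hdom]⟩) rfl
  refine this.symm.trans ?_
  have e : (LinearEquiv.ofInjective j hj).symm ⟨j k, ⟨k, rfl⟩⟩ = k := by
    rw [LinearEquiv.symm_apply_eq]; rfl
  exact congrArg f e

theorem extend_proj (hv : ∀ a b : V, a ∣ b ∨ b ∣ a)
    (hD : ∀ a : V, a ≠ 0 → ∀ d : D, ∃ m : D, a • m = d)
    {P : Type u} [AddCommGroup P] [Module V P] [Module.Projective V P] (L : Submodule V P)
    [Module.Projective V L] (f : L →ₗ[V] D) :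
    ∃ g : P →ₗ[V] D, ∀ k : L, g k = f k := by
  obtain ⟨i, hi⟩ := Module.projective_def.1 (inferInstance : Module.Projective V P)
  obtain ⟨g, hg⟩ := extend_free (i ∘ₗ L.subtype)
    (hi.injective.comp L.subtype_injective) hv hD f
  exact ⟨g ∘ₗ i, hg⟩

theorem ext_vanishes (hv : ∀ a b : V, a ∣ b ∨ b ∣ a)
    (hD : ∀ a : V, a ≠ 0 → ∀ d : D, ∃ m : D, a • m = d)
    (A : Type u) [AddCommGroup A] [Module V A] (hA : ProjDimLE1 V A) : Ext1Vanishes V A D := by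
  obtain ⟨P, g, hP, hg, hK⟩ := hA
  intro E _ _ i p hi hp hip
  obtain ⟨h, hh⟩ := Module.projective_lifting_property p g hp
  have hmem : ∀ k : LinearMap.ker g, h k ∈ LinearMap.range i := by
    intro k
    rw [hip, LinearMap.mem_ker, ← LinearMap.comp_apply, hh]
    exact k.2
  let e := LinearEquiv.ofInjective i hi
  let f : LinearMap.ker g →ₗ[V] D := e.symm.toLinearMap ∘ₗ
    LinearMap.codRestrict (LinearMap.range i) (h ∘ₗ (LinearMap.ker g).subtype) hmem
  have hf : ∀ k, i (f k) = h k := by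
    intro k
    have : (e (f k) : E) = h k := by
      simp only [f, LinearMap.comp_apply, LinearEquiv.coe_coe, LinearEquiv.apply_symm_apply]
      rfl
    exact this
  obtain ⟨g', hg'⟩ := extend_proj hv hD (LinearMap.ker g) f
  let s := Submodule.liftQ (LinearMap.ker g) (h - i ∘ₗ g') (by
    intro k hk
    have := hg' ⟨k, hk⟩
    simp only at this
    simp [this, hf])
  refine ⟨s ∘ₗ (g.quotKerEquivOfSurjective hg).symm.toLinearMap, ?_⟩
  ext a
  obtain ⟨x, rfl⟩ := hg a
  have : (g.quotKerEquivOfSurjective hg).symm (g x) = Submodule.Quotient.mk x := by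
    rw [LinearEquiv.symm_apply_eq]; rfl
  have h0 : p (i (g' x)) = 0 := by
    rw [← LinearMap.mem_ker, ← hip]; exact ⟨_, rfl⟩
  have h1 : p (h x) = g x := by rw [← hh]; rfl
  simp [this, s, h0, h1]

end ValExt

section SH
open scoped TensorProduct

variable {R : Type u} [CommRing R]

theorem exists_section (hsh : ∀ I : Ideal R, I.FG → Module.Projective R I) (s : R) :
    ∃ σ : (Ideal.span {s} : Ideal R) →ₗ[R] R, ∀ x, s * σ x = x := by
  have hP : Module.Projective R (Ideal.span {s} : Ideal R) := hsh _ ⟨{s}, by simp⟩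
  let g : R →ₗ[R] (Ideal.span {s} : Ideal R) :=
    LinearMap.toSpanSingleton R _ ⟨s, Ideal.mem_span_singleton_self s⟩
  have hg : Function.Surjective g := by
    rintro ⟨x, hx⟩
    obtain ⟨r, hr⟩ := Ideal.mem_span_singleton'.1 hx
    refine ⟨r, Subtype.ext ?_⟩
    simp [g, hr]
  obtain ⟨σ, hσ⟩ := Module.projective_lifting_property g LinearMap.id hg
  refine ⟨σ, fun x => ?_⟩
  have := congrArg Subtype.val (LinearMap.congr_fun hσ x)
  simp only [g, LinearMap.comp_apply, LinearMap.id_apply, LinearMap.toSpanSingleton_apply] at this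
  rw [← this, mul_comm]; rfl

theorem exists_pp (hsh : ∀ I : Ideal R, I.FG → Module.Projective R I) (s : R) :
    ∃ σ : (Ideal.span {s} : Ideal R) →ₗ[R] R, (∀ x, s * σ x = x) ∧
      ∀ r, s * r = 0 → σ ⟨s, Ideal.mem_span_singleton_self s⟩ * r = 0 := by
  obtain ⟨σ, hσ⟩ := exists_section hsh s
  refine ⟨σ, hσ, fun r hr => ?_⟩
  have : r • (⟨s, Ideal.mem_span_singleton_self s⟩ : (Ideal.span {s} : Ideal R)) = 0 :=
    Subtype.ext (by simp [mul_comm r, hr])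
  rw [mul_comm, ← smul_eq_mul, ← map_smul, this, map_zero]

theorem unit_of_not_mem (p : Ideal R) [p.IsPrime] {r : R} (h : r ∉ p) :
    IsUnit (algebraMap R (Localization.AtPrime p) r) :=
  IsLocalization.map_units (Localization.AtPrime p) (⟨r, h⟩ : p.primeCompl)

theorem sub_not_mem (p : Ideal R) [hp : p.IsPrime] {r : R} (h : r ∈ p) : 1 - r ∉ p := by
  intro h'
  exact hp.ne_top ((Ideal.eq_top_iff_one _).2 (by simpa using p.add_mem h' h))

/-- idempotent-like alternative -/
theorem map_eq_zero_or (p : Ideal R) [p.IsPrime] {s f : R} (h : s * f = s)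
    (hf : ∀ r, s * r = 0 → f * r = 0) :
    algebraMap R (Localization.AtPrime p) s = 0 ∨
      (f ∉ p ∧ algebraMap R (Localization.AtPrime p) f = 1) := by
  by_cases hfp : f ∈ p
  · left
    refine (unit_of_not_mem p (sub_not_mem p hfp)).mul_left_eq_zero.1 ?_
    rw [← map_mul, mul_sub, h]; simp
  · right
    refine ⟨hfp, (unit_of_not_mem p hfp).mul_left_cancel ?_⟩
    have := hf (1 - f) (by rw [mul_sub, h]; simp)
    rw [← map_mul, mul_one]
    congr 1
    linear_combination -this

theorem loc_isDomain (hsh : ∀ I : Ideal R, I.FG → Module.Projective R I)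
    (p : Ideal R) [p.IsPrime] : IsDomain (Localization.AtPrime p) := by
  have : NoZeroDivisors (Localization.AtPrime p) := by
    constructor
    intro a b hab
    obtain ⟨s, t, rfl⟩ := IsLocalization.exists_mk'_eq p.primeCompl a
    obtain ⟨r, t', rfl⟩ := IsLocalization.exists_mk'_eq p.primeCompl b
    rw [← IsLocalization.mk'_mul, IsLocalization.mk'_eq_zero_iff] at hab
    obtain ⟨w, hw⟩ := hab
    obtain ⟨σ, h1, h2⟩ := exists_pp hsh s
    rcases map_eq_zero_or p (h1 _) h2 with h | ⟨h, h'⟩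
    · left
      rw [IsLocalization.mk'_eq_zero_iff]
      exact (IsLocalization.map_eq_zero_iff p.primeCompl _ _).1 h
    · right
      rw [IsLocalization.mk'_eq_zero_iff]
      refine ⟨⟨_, h⟩ * w, ?_⟩
      have := h2 (w * r) (by linear_combination hw)
      simp only [Submonoid.coe_mul]
      linear_combination this
  exact NoZeroDivisors.to_isDomain _

theorem loc_total (hsh : ∀ I : Ideal R, I.FG → Module.Projective R I)
    (p : Ideal R) [p.IsPrime] (x y : Localization.AtPrime p) : x ∣ y ∨ y ∣ x := by
  obtain ⟨a, t, rfl⟩ := IsLocalization.exists_mk'_eq p.primeCompl x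
  obtain ⟨b, t', rfl⟩ := IsLocalization.exists_mk'_eq p.primeCompl y
  have key : ∀ (r : R) (t : p.primeCompl),
      Associated (algebraMap R (Localization.AtPrime p) r)
        (IsLocalization.mk' (Localization.AtPrime p) r t) := by
    intro r t
    refine Associated.symm ⟨(unit_of_not_mem p t.2).unit, ?_⟩
    exact IsLocalization.mk'_spec _ _ _
  rw [← (key a t).dvd_iff_dvd_left, ← (key a t).dvd_iff_dvd_right,
    ← (key b t').dvd_iff_dvd_left, ← (key b t').dvd_iff_dvd_right]
  let I : Ideal R := Ideal.span {a, b}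
  have ha : a ∈ I := Ideal.subset_span (by simp)
  have hb : b ∈ I := Ideal.subset_span (by simp)
  have hP : Module.Projective R I := hsh _ (Submodule.fg_span (Set.toFinite _))
  let g : (R × R) →ₗ[R] I := (LinearMap.toSpanSingleton R I ⟨a, ha⟩).coprod
    (LinearMap.toSpanSingleton R I ⟨b, hb⟩)
  have hg : Function.Surjective g := by
    rintro ⟨x, hx⟩
    obtain ⟨r, q, hr⟩ := Ideal.mem_span_pair.1 hx
    refine ⟨(r, q), Subtype.ext ?_⟩
    simp [g, hr]
  obtain ⟨σ, hσ⟩ := Module.projective_lifting_property g LinearMap.id hg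
  have h1 := congrArg Subtype.val (LinearMap.congr_fun hσ ⟨a, ha⟩)
  have h2 : b • σ ⟨a, ha⟩ = a • σ ⟨b, hb⟩ := by
    rw [← map_smul, ← map_smul]; congr 1; exact Subtype.ext (mul_comm b a)
  have h3 := congrArg Prod.fst h2
  simp [g] at h1 h3
  generalize σ ⟨a, ha⟩ = u at *
  generalize σ ⟨b, hb⟩ = v at *
  by_cases hu : u.1 ∈ p
  · right
    rw [← (unit_of_not_mem p (sub_not_mem p hu)).dvd_mul_left, ← map_mul]
    refine map_dvd _ ⟨u.2, ?_⟩
    linear_combination -h1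
  · left
    rw [← (unit_of_not_mem p hu).dvd_mul_left, ← map_mul]
    refine map_dvd _ ⟨v.1, ?_⟩
    linear_combination h3

/-- divisibility over R -/
def DivR (R : Type u) [CommRing R] (N : Type u) [AddCommGroup N] [Module R N] : Prop :=
  ∀ (s : R) (σ : (Ideal.span {s} : Ideal R) →ₗ[R] R), (∀ x, s * σ x = x) → ∀ n : N,
    ∃ n' : N, s • n' = σ ⟨s, Ideal.mem_span_singleton_self s⟩ • n

theorem divR_of_BClass (hsh : ∀ I : Ideal R, I.FG → Module.Projective R I)
    (N : ModuleCat.{u} R) (hN : N ∈ BClass R) : DivR R N := by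
  intro s σ hσ n
  let I : Ideal R := Ideal.span {s}
  have hQ : ProjDimLE1 R (ModuleCat.of R (R ⧸ I)) := by
    refine ⟨ModuleCat.of R R, Submodule.mkQ I, ?_, Submodule.mkQ_surjective I, ?_⟩
    · change Module.Projective R R
      infer_instance
    · have : Module.Projective R I := hsh _ ⟨{s}, by simp [I]⟩
      exact Module.Projective.of_equiv (LinearEquiv.ofEq _ _ (Submodule.ker_mkQ I).symm)
  let θ : I →ₗ[R] (N × R) := ((LinearMap.toSpanSingleton R N n) ∘ₗ σ).prod (-I.subtype)
  have hθ : ∀ x, θ x = (σ x • n, -(x : R)) := fun x => rfl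
  let E := (N × R) ⧸ LinearMap.range θ
  let i : N →ₗ[R] E := Submodule.mkQ _ ∘ₗ LinearMap.inl R N R
  let q : E →ₗ[R] (R ⧸ I) := Submodule.liftQ _ (Submodule.mkQ I ∘ₗ LinearMap.snd R N R) (by
    rintro _ ⟨x, rfl⟩
    rw [hθ]
    simpa using Ideal.Quotient.eq_zero_iff_mem.2 x.2)
  have hq : ∀ m r, q (Submodule.Quotient.mk (m, r)) = Submodule.Quotient.mk r := fun m r => rfl
  have hinj : Function.Injective i := by
    intro a b hab
    have : (Submodule.Quotient.mk (a, 0) : E) = Submodule.Quotient.mk (b, 0) := hab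
    rw [Submodule.Quotient.eq] at this
    obtain ⟨x, hx⟩ := this
    rw [hθ, Prod.ext_iff] at hx
    simp at hx
    obtain ⟨hx1, hx2⟩ := hx
    subst hx2
    simp at hx1
    exact (sub_eq_zero.1 hx1.symm)
  have hsurj : Function.Surjective q := by
    intro y
    obtain ⟨r, rfl⟩ := Submodule.Quotient.mk_surjective _ y
    exact ⟨Submodule.Quotient.mk (0, r), rfl⟩
  have hex : LinearMap.range i = LinearMap.ker q := by
    ext e
    constructor
    · rintro ⟨a, rfl⟩
      change q (Submodule.Quotient.mk (a, 0)) = 0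
      rw [hq]; rfl
    · intro he
      obtain ⟨⟨m, r⟩, rfl⟩ := Submodule.Quotient.mk_surjective _ e
      have he : q (Submodule.Quotient.mk (m, r)) = 0 := he
      rw [hq, Submodule.Quotient.mk_eq_zero] at he
      refine ⟨m + σ ⟨r, he⟩ • n, ?_⟩
      change (Submodule.Quotient.mk (m + σ ⟨r, he⟩ • n, 0) : E) = _
      rw [Submodule.Quotient.eq]
      refine ⟨⟨r, he⟩, ?_⟩
      rw [hθ]
      simp
  obtain ⟨t, ht⟩ := hN _ hQ E i q hinj hsurj hex
  obtain ⟨⟨m, r⟩, hm⟩ := Submodule.Quotient.mk_surjective _ (t (Submodule.Quotient.mk 1))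
  have h1 : q (t (Submodule.Quotient.mk 1)) = Submodule.Quotient.mk 1 :=
    LinearMap.congr_fun ht _
  rw [← hm, hq, Submodule.Quotient.eq] at h1
  have h2 : t (s • Submodule.Quotient.mk 1) = 0 := by
    have : (s • Submodule.Quotient.mk 1 : R ⧸ I) = 0 := by
      rw [← Submodule.Quotient.mk_smul, Submodule.Quotient.mk_eq_zero]
      simp [I, Ideal.mem_span_singleton_self s]
    rw [this]; exact map_zero _
  have h3 : s • t (Submodule.Quotient.mk 1) = 0 := by rw [← h2]; exact (map_smul t s _).symm
  rw [← hm, ← Submodule.Quotient.mk_smul, Submodule.Quotient.mk_eq_zero] at h3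
  obtain ⟨x, hx⟩ := h3
  rw [hθ, Prod.ext_iff] at hx
  obtain ⟨hx1, hx2⟩ := hx
  simp at hx1 hx2
  -- x = - s r, r = 1 + y
  refine ⟨-(m + σ ⟨r - 1, h1⟩ • n), ?_⟩
  rw [smul_neg, smul_add, ← hx1, smul_smul, ← add_smul, ← neg_smul]
  congr 1
  rw [← smul_eq_mul, ← map_smul, ← map_add, ← map_neg]
  congr 1
  refine Subtype.ext ?_
  simp
  linear_combination hx2

theorem div_of_divR (hsh : ∀ I : Ideal R, I.FG → Module.Projective R I)
    (p : Ideal R) [p.IsPrime] {D : Type u} [AddCommGroup D] [Module R D]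
    [Module (Localization.AtPrime p) D] [IsScalarTower R (Localization.AtPrime p) D]
    (hD : DivR R D) (a : Localization.AtPrime p) (ha : a ≠ 0) (d : D) : ∃ m : D, a • m = d := by
  obtain ⟨s, t, rfl⟩ := IsLocalization.exists_mk'_eq p.primeCompl a
  obtain ⟨σ, h1, h2⟩ := exists_pp hsh s
  have hs : algebraMap R (Localization.AtPrime p) s ≠ 0 := by
    intro h
    apply ha
    rw [IsLocalization.mk'_eq_zero_iff]
    exact (IsLocalization.map_eq_zero_iff p.primeCompl _ _).1 h
  obtain ⟨n, hn⟩ := hD s σ h1 d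
  have h := ((map_eq_zero_or p (h1 _) h2).resolve_left hs).2
  refine ⟨(t : R) • n, ?_⟩
  rw [← algebraMap_smul (Localization.AtPrime p) (t : R) n, smul_smul, IsLocalization.mk'_spec,
    algebraMap_smul, hn, ← algebraMap_smul (Localization.AtPrime p), h, one_smul]

theorem divR_tensor (p : Ideal R) [p.IsPrime] {N : Type u} [AddCommGroup N] [Module R N]
    (hN : DivR R N) : DivR R (TensorProduct R (Localization.AtPrime p) N) := by
  intro s σ hσ n
  induction n using TensorProduct.induction_on with
  | zero => exact ⟨0, by simp⟩
  | tmul v n =>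
    obtain ⟨n', h⟩ := hN s σ hσ n
    exact ⟨v ⊗ₜ n', by rw [← TensorProduct.tmul_smul, h, TensorProduct.tmul_smul]⟩
  | add x y hx hy =>
    obtain ⟨x', hx⟩ := hx
    obtain ⟨y', hy⟩ := hy
    exact ⟨x' + y', by rw [smul_add, smul_add, hx, hy]⟩

end SH

section Cov
open scoped TensorProduct
variable {R : Type u} [CommRing R]

theorem divR_ker (hsh : ∀ I : Ideal R, I.FG → Module.Projective R I)
    (A : ModuleCat.{u} R) (M : Type u) [AddCommGroup M] [Module R M] (φ : A →ₗ[R] M)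
    (hφ : IsCover R (P1Class R) A M φ) : DivR R (LinearMap.ker φ) := by
  obtain ⟨⟨P, g, hP, hg, hK⟩, hpre, hend⟩ := hφ
  rintro s σ hσ ⟨k, hk⟩
  have hk : φ k = 0 := hk
  obtain ⟨l, hl⟩ := hg k
  let I : Ideal R := Ideal.span {s}
  have hI : Module.Projective R I := hsh _ ⟨{s}, by simp [I]⟩
  let θ : (LinearMap.ker g × I) →ₗ[R] (P × R) :=
    (((LinearMap.ker g).subtype).coprod ((LinearMap.toSpanSingleton R P l) ∘ₗ σ)).prod
      (-(I.subtype ∘ₗ LinearMap.snd R _ _))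
  have hθ : ∀ x y, θ (x, y) = ((x : P) + σ y • l, -(y : R)) := fun x y => rfl
  have hθi : Function.Injective θ := by
    rw [← LinearMap.ker_eq_bot, LinearMap.ker_eq_bot']
    rintro ⟨x, y⟩ h
    rw [hθ, Prod.ext_iff] at h
    obtain ⟨h1, h2⟩ := h
    have h2 : y = 0 := Subtype.ext (by simpa using h2)
    subst h2
    have h1 : x = 0 := Subtype.ext (by simpa using h1)
    rw [h1]; rfl
  let E := (P × R) ⧸ LinearMap.range θ
  have hE : ProjDimLE1 R (ModuleCat.of R E) := by
    refine ⟨ModuleCat.of R (P × R), Submodule.mkQ _, ?_, Submodule.mkQ_surjective _, ?_⟩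
    · change Module.Projective R (P × R)
      infer_instance
    · exact Module.Projective.of_equiv ((LinearEquiv.ofInjective θ hθi).trans
        (LinearEquiv.ofEq _ _ (Submodule.ker_mkQ _).symm))
  let ψ : E →ₗ[R] M := Submodule.liftQ _ (φ ∘ₗ g ∘ₗ LinearMap.fst R P R) (by
    rintro _ ⟨⟨x, y⟩, rfl⟩
    have hx : g x = 0 := x.2
    rw [hθ]
    simp [hx, hl, hk])
  obtain ⟨h, hh⟩ := hpre (ModuleCat.of R E) hE ψ
  let h : E →ₗ[R] A := h
  have hh : ∀ q r, φ (h (Submodule.Quotient.mk (q, r))) = φ (g q) :=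
    fun q r => LinearMap.congr_fun hh (Submodule.Quotient.mk (q, r))
  let v : P →ₗ[R] A := h ∘ₗ Submodule.mkQ _ ∘ₗ LinearMap.inl R P R
  have hv : ∀ q, v q = h (Submodule.Quotient.mk (q, 0)) := fun q => rfl
  have hv0 : LinearMap.ker g ≤ LinearMap.ker v := by
    intro x hx
    rw [LinearMap.mem_ker, hv]
    have : (Submodule.Quotient.mk (x, 0) : E) = 0 := by
      rw [Submodule.Quotient.mk_eq_zero]
      exact ⟨(⟨x, hx⟩, 0), by rw [hθ]; simp⟩
    rw [this, map_zero]
  let w : A →ₗ[R] A := Submodule.liftQ _ v hv0 ∘ₗ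
    (g.quotKerEquivOfSurjective hg).symm.toLinearMap
  have hw : ∀ q, w (g q) = v q := by
    intro q
    have : (g.quotKerEquivOfSurjective hg).symm (g q) = Submodule.Quotient.mk q := by
      rw [LinearEquiv.symm_apply_eq]; rfl
    simp [w, this]
  have hφw : φ.comp w = φ := by
    ext a
    obtain ⟨q, rfl⟩ := hg a
    rw [LinearMap.comp_apply, hw, hv, hh]
  have hbij := hend w hφw
  obtain ⟨k', hk'⟩ := hbij.2 (h (Submodule.Quotient.mk (0, 1)))
  have hk0 : φ k' = 0 := by
    rw [← hφw, LinearMap.comp_apply, hk', hh]; simp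
  refine ⟨⟨k', hk0⟩, Subtype.ext ?_⟩
  apply hbij.1
  change w (s • k') = w (_ • k)
  rw [map_smul, map_smul, hk', ← hl, hw, hv, ← map_smul, ← map_smul,
    ← Submodule.Quotient.mk_smul, ← Submodule.Quotient.mk_smul]
  congr 1
  rw [eq_comm, Submodule.Quotient.eq]
  refine ⟨(0, ⟨s, Ideal.mem_span_singleton_self s⟩), ?_⟩
  rw [hθ]
  simp

theorem p1_loc (p : Ideal R) [p.IsPrime] (A : Type u) [AddCommGroup A] [Module R A]
    [Module (Localization.AtPrime p) A] [IsScalarTower R (Localization.AtPrime p) A]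
    [IsLocalizedModule p.primeCompl (LinearMap.id : A →ₗ[R] A)]
    (hA : ProjDimLE1 R A) : ProjDimLE1 (Localization.AtPrime p) A := by
  obtain ⟨P, g, hP, hg, hK⟩ := hA
  let V := Localization.AtPrime p
  have hb : IsBaseChange V (LinearMap.id : A →ₗ[R] A) :=
    IsLocalizedModule.isBaseChange p.primeCompl V _
  let G : (V ⊗[R] P) →ₗ[V] A := hb.equiv.toLinearMap ∘ₗ g.baseChange V
  have hGs : Function.Surjective G :=
    hb.equiv.surjective.comp (LinearMap.lTensor_surjective V hg)
  have : Module.Flat R V := IsLocalization.flat V p.primeCompl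
  refine ⟨ModuleCat.of V (V ⊗[R] P), G, ?_, hGs, ?_⟩
  · change Module.Projective V (V ⊗[R] P)
    infer_instance
  · let J : (V ⊗[R] LinearMap.ker g) →ₗ[V] (V ⊗[R] P) := (LinearMap.ker g).subtype.baseChange V
    have hJ : Function.Injective J :=
      Module.Flat.lTensor_preserves_injective_linearMap (M := V) _
        (LinearMap.ker g).subtype_injective
    have hr : LinearMap.range J = LinearMap.ker G := by
      have hex : Function.Exact ((LinearMap.ker g).subtype.lTensor V) (g.lTensor V) :=
        lTensor_exact V (LinearMap.exact_subtype_ker_map g) hg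
      ext x
      have h1 : x ∈ LinearMap.ker G ↔ g.lTensor V x = 0 := by
        change hb.equiv (g.lTensor V x) = 0 ↔ _
        rw [LinearEquiv.map_eq_zero_iff]
      rw [h1, hex x]
      rfl
    exact Module.Projective.of_equiv ((LinearEquiv.ofInjective J hJ).trans
        (LinearEquiv.ofEq _ _ hr))

theorem isCover_loc (hsh : ∀ I : Ideal R, I.FG → Module.Projective R I)
    (p : Ideal R) [p.IsPrime] (M : Type u) [AddCommGroup M] [Module R M]
    [Module (Localization.AtPrime p) M] [IsScalarTower R (Localization.AtPrime p) M]
    (A : ModuleCat.{u} R)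
    [Module (Localization.AtPrime p) A] [IsScalarTower R (Localization.AtPrime p) A]
    [IsLocalizedModule p.primeCompl (LinearMap.id : A →ₗ[R] A)] (φ : A →ₗ[R] M)
    (hφ : IsCover R (P1Class R) A M φ) :
    IsCover (Localization.AtPrime p) (P1Class (Localization.AtPrime p))
      (ModuleCat.of (Localization.AtPrime p) A) M
      (φ.extendScalarsOfIsLocalization p.primeCompl (Localization.AtPrime p)) := by
  have hdiv := divR_ker hsh A M φ hφ
  have := loc_isDomain hsh p
  set Φ := φ.extendScalarsOfIsLocalization p.primeCompl (Localization.AtPrime p) with hΦ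
  have hΦa : ∀ a, Φ a = φ a := fun a => rfl
  have hker : ∀ a : Localization.AtPrime p, a ≠ 0 → ∀ d : LinearMap.ker Φ,
      ∃ m : LinearMap.ker Φ, a • m = d := by
    refine div_of_divR hsh p (D := LinearMap.ker Φ) ?_
    intro s σ hσ n
    obtain ⟨n', hn'⟩ := hdiv s σ hσ ⟨n.1, n.2⟩
    refine ⟨⟨n'.1, n'.2⟩, Subtype.ext ?_⟩
    exact congrArg Subtype.val hn'
  have hsurj : Function.Surjective φ := by
    intro m
    have hR : ProjDimLE1 R (ModuleCat.of R R) := by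
      refine ⟨ModuleCat.of R R, LinearMap.id, ?_, Function.surjective_id, ?_⟩
      · change Module.Projective R R
        infer_instance
      · rw [LinearMap.ker_id]; infer_instance
    obtain ⟨h, hh⟩ := hφ.2.1 (ModuleCat.of R R) hR (LinearMap.toSpanSingleton R M m)
    refine ⟨h (1 : R), ?_⟩
    have := LinearMap.congr_fun hh (1 : R)
    simpa using this
  refine ⟨p1_loc p A hφ.1, ?_, ?_⟩
  · intro P' hP' ψ
    have hext := ext_vanishes (D := LinearMap.ker Φ) (loc_total hsh p) hker P' hP'
    let T : (A × P') →ₗ[Localization.AtPrime p] M :=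
      Φ ∘ₗ LinearMap.fst _ _ _ - ψ ∘ₗ LinearMap.snd _ _ _
    have hT : ∀ a b, T (a, b) = Φ a - ψ b := fun a b => rfl
    let i : LinearMap.ker Φ →ₗ[Localization.AtPrime p] LinearMap.ker T :=
      LinearMap.codRestrict _ (LinearMap.inl _ _ _ ∘ₗ (LinearMap.ker Φ).subtype) (by
        rintro ⟨x, hx⟩
        have hx : Φ x = 0 := hx
        change T (x, 0) = 0
        rw [hT, hx]; simp)
    let q : LinearMap.ker T →ₗ[Localization.AtPrime p] P' :=
      LinearMap.snd _ _ _ ∘ₗ (LinearMap.ker T).subtype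
    have hi : Function.Injective i := by
      intro x y hxy
      exact Subtype.ext (congrArg (fun z => z.1.1) hxy)
    have hq : Function.Surjective q := by
      intro b
      obtain ⟨a, ha⟩ := hsurj (ψ b)
      refine ⟨⟨(a, b), ?_⟩, rfl⟩
      rw [LinearMap.mem_ker, hT, hΦa, ha, sub_self]
    have hiq : LinearMap.range i = LinearMap.ker q := by
      ext x
      constructor
      · rintro ⟨y, rfl⟩
        rfl
      · obtain ⟨⟨a, b⟩, hx⟩ := x
        intro h
        have h : b = 0 := h
        subst h
        have hx' : T (a, 0) = 0 := hx
        rw [hT, map_zero, sub_zero] at hx'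
        exact ⟨⟨a, hx'⟩, rfl⟩
    obtain ⟨t, ht⟩ := hext _ i q hi hq hiq
    refine ⟨LinearMap.fst _ _ _ ∘ₗ (LinearMap.ker T).subtype ∘ₗ t, ?_⟩
    ext b
    have h1 : q (t b) = b := LinearMap.congr_fun ht b
    have h2 : T ((t b).1.1, (t b).1.2) = 0 := (t b).2
    rw [hT, sub_eq_zero] at h2
    exact h2.trans (congrArg ψ h1)
  · intro e he
    let e' : A →ₗ[Localization.AtPrime p] A := e
    exact hφ.2.2 (e'.restrictScalars R) (LinearMap.ext fun x => LinearMap.congr_fun he x)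

theorem cover_loc (hsh : ∀ I : Ideal R, I.FG → Module.Projective R I)
    (p : Ideal R) [p.IsPrime] (M : Type u) [AddCommGroup M] [Module R M]
    [Module (Localization.AtPrime p) M] [IsScalarTower R (Localization.AtPrime p) M]
    (hcov : IsCoveringClass R (P1Class R)) :
    ∃ (P : ModuleCat.{u} (Localization.AtPrime p)) (φ : P →ₗ[Localization.AtPrime p] M),
      IsCover (Localization.AtPrime p) (P1Class (Localization.AtPrime p)) P M φ := by
  obtain ⟨A, φ, hφ⟩ := hcov (ModuleCat.of R M)
  let φ : A →ₗ[R] M := φ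
  have hφ : IsCover R (P1Class R) A M φ := hφ
  have hbij : ∀ s : p.primeCompl, Function.Bijective (fun a : A => (s : R) • a) := by
    intro s
    let c := IsLocalization.mk' (Localization.AtPrime p) (1 : R) s
    obtain ⟨h, hh⟩ := hφ.2.1 A hφ.1
      ((LinearMap.lsmul (Localization.AtPrime p) M c).restrictScalars R ∘ₗ φ)
    have hh' : ∀ a, φ (h a) = c • φ a := fun a => LinearMap.congr_fun hh a
    have hb := hφ.2.2 ((s : R) • h) (by
      ext a
      simp only [LinearMap.comp_apply, LinearMap.smul_apply, map_smul, hh']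
      rw [← algebraMap_smul (Localization.AtPrime p) (s : R), smul_smul, mul_comm,
        IsLocalization.mk'_spec, map_one, one_smul])
    constructor
    · intro a b hab
      apply hb.1
      simp only [LinearMap.smul_apply, ← map_smul]
      exact congrArg h hab
    · intro a
      obtain ⟨b, hb⟩ := hb.2 a
      exact ⟨h b, hb⟩
  have hloc : IsLocalizedModule p.primeCompl (LinearMap.id : A →ₗ[R] A) := by
    refine ⟨fun s => ?_, fun y => ⟨(y, 1), by simp⟩, fun {x y} h => ⟨1, by simpa using h⟩⟩
    rw [Module.End.isUnit_iff]
    exact hbij s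
  let : Module (Localization.AtPrime p) A :=
    IsLocalizedModule.module p.primeCompl (LinearMap.id : A →ₗ[R] A)
  have : IsScalarTower R (Localization.AtPrime p) A :=
    IsLocalizedModule.isScalarTower_module p.primeCompl (LinearMap.id : A →ₗ[R] A)
  exact ⟨_, _, isCover_loc hsh p M A φ hφ⟩

end Cov

/-- **Lemma 6.4 ((ii) and (iii)).** Let `R` be a commutative semihereditary ring and `𝔭`
a prime ideal of `R`. If `𝒫₁(R)` is covering in `Mod-R`, then `𝒫₁(R_𝔭)` is covering in
`Mod-R_𝔭`. Moreover, for every `N ∈ ℬ(R)` one has `N ⊗_R R_𝔭 ∈ ℬ(R_𝔭)`. -/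
theorem localization_covering_and_BClass (R : Type u) [CommRing R]
    (hsh : ∀ I : Ideal R, I.FG → Module.Projective R I)
    (p : Ideal R) [p.IsPrime] :
    (IsCoveringClass R (P1Class R) →
      IsCoveringClass (Localization.AtPrime p) (P1Class (Localization.AtPrime p))) ∧
    (∀ N : ModuleCat.{u} R, N ∈ BClass R →
      ModuleCat.of (Localization.AtPrime p)
        (TensorProduct R (Localization.AtPrime p) (N : Type u)) ∈
          BClass (Localization.AtPrime p)) := by
  refine ⟨fun hcov M => ?_, fun N hN P hP => ?_⟩
  · let : Module R M := Module.compHom M (algebraMap R (Localization.AtPrime p))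
    have : IsScalarTower R (Localization.AtPrime p) M := by
      refine ⟨fun r v m => ?_⟩
      change _ = algebraMap R (Localization.AtPrime p) r • (v • m)
      rw [Algebra.smul_def, mul_smul]
    exact cover_loc hsh p M hcov
  · have := loc_isDomain hsh p
    exact ext_vanishes (loc_total hsh p)
      (div_of_divR hsh p (divR_tensor p (divR_of_BClass hsh N hN))) P hP
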